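/- Let A,B,C,D,E ∈ ℝ with Pf := −B² + AC − DE ≠ 0, and let ρ be the 4×4 real matrix ρ := |Pf|^{−1/2} • !![B,-A,0,-D; C,-B,D,0; 0,E,B,C; -E,0,-A,-B]. Then ρ * ρ = −(Pf/|Pf|) • 1; in particular ρ * ρ = 1 when Pf < 0 and ρ * ρ = −1 when Pf > 0. -/

import Mathlib

theorem lychaginRubtsov_matrix_mul_self {R : Type*} [CommRing R] (A B C D E : R) :
    !![B,-A,0,-D; C,-B,D,0; 0,E,B,C; -E,0,-A,-B] *
      !![B,-A,0,-D; C,-B,D,0; 0,E,B,C; -E,0,-A,-B] =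
      (-(-B ^ 2 + A * C - D * E)) • (1 : Matrix (Fin 4) (Fin 4) R) := by
  ext i j
  fin_cases i <;> fin_cases j <;>
    simp [Matrix.mul_apply, Fin.sum_univ_four] <;> ring

/-- Proposition 3.7, the Lychagin–Rubtsov endomorphism squares to
−sgn(Pf)·Id. -/
theorem statement_4 (A B C D E : ℝ) (hPf : -B ^ 2 + A * C - D * E ≠ 0)
    (ρ : Matrix (Fin 4) (Fin 4) ℝ)
    (hρ : ρ = (Real.sqrt |(-B ^ 2 + A * C - D * E)|)⁻¹ •
      !![B,-A,0,-D; C,-B,D,0; 0,E,B,C; -E,0,-A,-B]) :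
    ρ * ρ = (-((-B ^ 2 + A * C - D * E) / |(-B ^ 2 + A * C - D * E)|)) •
      (1 : Matrix (Fin 4) (Fin 4) ℝ) ∧
    (-B ^ 2 + A * C - D * E < 0 → ρ * ρ = 1) ∧
    (0 < -B ^ 2 + A * C - D * E → ρ * ρ = -1) := by
  have hsq : ρ * ρ = (-((-B ^ 2 + A * C - D * E) / |(-B ^ 2 + A * C - D * E)|)) •
      (1 : Matrix (Fin 4) (Fin 4) ℝ) := by
    rw [hρ, Matrix.smul_mul, Matrix.mul_smul, lychaginRubtsov_matrix_mul_self, smul_smul,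
      smul_smul, ← mul_inv, Real.mul_self_sqrt (abs_nonneg _), mul_neg, div_eq_inv_mul]
  refine ⟨hsq, fun h => ?_, fun h => ?_⟩
  · rw [hsq, abs_of_neg h, div_neg, div_self hPf, neg_neg, one_smul]
  · rw [hsq, abs_of_pos h, div_self hPf, neg_one_smul]
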